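/- Let X be an integral domain and let f, g : X → X satisfy g(x+y) − g(x) − g(y) = x·f(y) + y·f(x) for all x, y ∈ X. Then f(2x) = 3·f(x) + f(−x) for all x ∈ X. -/

import Mathlib

/-- The Cauchy difference of `f` is a multiple of the product, by the cocycle identity for the
Cauchy difference of `g`. -/
theorem cauchy_difference_eq_mul {X : Type*} [CommRing X] (f g : X → X)
    (h : ∀ x y : X, g (x + y) - g x - g y = x * f y + y * f x) (x y : X) :
    f (x + y) - f x - f y = x * y * (f (1 + 1) - f 1 - f 1) := by
  have cocycle (x y z : X) :
      z * (f (x + y) - f x - f y) = x * (f (y + z) - f y - f z) := by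
    have h₁ := h (x + y) z
    rw [add_assoc] at h₁
    linear_combination h y z + h x (y + z) - h x y - h₁
  linear_combination cocycle x y 1 + x * cocycle y 1 1

theorem stmt_15 {X : Type*} [CommRing X] [IsDomain X] (f g : X → X)
    (h : ∀ x y : X, g (x + y) - g x - g y = x * f y + y * f x) :
    ∀ x : X, f (2 * x) = 3 * f x + f (-x) := by
  intro x
  have h_zero := cauchy_difference_eq_mul f g h 0 0
  have h_double := cauchy_difference_eq_mul f g h x x
  have h_neg := cauchy_difference_eq_mul f g h x (-x)
  rw [add_zero] at h_zero
  rw [add_neg_cancel] at h_neg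
  rw [two_mul]
  linear_combination h_double + h_neg + h_zero
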